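/- Let Δ = C₁ ∪ C₂ be a finite set of variables with S = C₁ ∩ C₂, let n : I → ℕ be a cell frequency function with total count N = ∑_{i∈I} n(i) > 0, and for a ⊆ Δ and t ∈ I_a let r(t) = (∑_{j : j_a = t} n(j))/N. Define q : I → ℝ by q(i) = r(i_{C₁}) r(i_{C₂}) / r(i_S) if r(i_S) > 0 and q(i) = 0 otherwise. Then q maximizes the log-likelihood over the decomposable model with cliques C₁ and C₂: for every p : I → ℝ such that p(i) ≥ 0 for all i, ∑_{i∈I} p(i) = 1, p(i) > 0 whenever n(i) > 0, and p factorizes as p(i) = f(i_{C₁}) g(i_{C₂}) for some nonnegative functions f on I_{C₁} and g on I_{C₂}, one has ∑_{i : n(i) > 0} n(i) · log p(i) ≤ ∑_{i : n(i) > 0} n(i) · log q(i). (Note that n(i) > 0 implies r(i_S) > 0 and hence q(i) > 0, so the right-hand side is well defined.) -/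

import Mathlib

open Finset

/-- The `a`-marginal of a cell `i`: the restriction of `i` to the coordinates in `a`. -/
def marg {Δ : Type*} {I : Δ → Type*} (i : ∀ δ, I δ) (a : Finset Δ) : ∀ δ : a, I δ.1 :=
  fun δ => i δ.1

lemma marg_eq_iff {Δ : Type*} {I : Δ → Type*} {i j : ∀ δ, I δ} {a : Finset Δ} :
    marg i a = marg j a ↔ ∀ δ ∈ a, i δ = j δ := by
  simp [marg, funext_iff]

section DecomposableModel

variable {Δ : Type*} [Fintype Δ] [DecidableEq Δ] {I : Δ → Type*}
  [∀ δ, Fintype (I δ)] [∀ δ, DecidableEq (I δ)]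

/-- The marginal table of `w` over the variables in `a`. -/
def margSum (w : (∀ δ, I δ) → ℝ) (a : Finset Δ) (t : ∀ δ : a, I δ.1) : ℝ :=
  ∑ j ∈ univ.filter (fun j => marg j a = t), w j

/-- The product of the `C₁`- and `C₂`-marginals of `w`, divided by the marginal over
the separator `C₁ ∩ C₂`. -/
noncomputable def decomposableFit (w : (∀ δ, I δ) → ℝ) (C₁ C₂ : Finset Δ)
    (i : ∀ δ, I δ) : ℝ :=
  margSum w C₁ (marg i C₁) * margSum w C₂ (marg i C₂) /
    margSum w (C₁ ∩ C₂) (marg i (C₁ ∩ C₂))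

lemma margSum_nonneg {w : (∀ δ, I δ) → ℝ} (hw : ∀ i, 0 ≤ w i) (a : Finset Δ)
    (t : ∀ δ : a, I δ.1) : 0 ≤ margSum w a t :=
  sum_nonneg fun j _ => hw j

lemma le_margSum {w : (∀ δ, I δ) → ℝ} (hw : ∀ i, 0 ≤ w i) (a : Finset Δ) (i : ∀ δ, I δ) :
    w i ≤ margSum w a (marg i a) :=
  single_le_sum (f := w) (fun j _ => hw j) (by simp)

lemma exists_pos_of_margSum_pos {w : (∀ δ, I δ) → ℝ} {a : Finset Δ}
    {t : ∀ δ : a, I δ.1} (h : 0 < margSum w a t) : ∃ j, marg j a = t ∧ 0 < w j := by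
  by_contra! hc
  exact h.not_ge (sum_nonpos fun j hj => hc j (by simpa using hj))

lemma decomposableFit_nonneg {w : (∀ δ, I δ) → ℝ} (hw : ∀ i, 0 ≤ w i) (C₁ C₂ : Finset Δ)
    (i : ∀ δ, I δ) : 0 ≤ decomposableFit w C₁ C₂ i :=
  div_nonneg (mul_nonneg (margSum_nonneg hw _ _) (margSum_nonneg hw _ _))
    (margSum_nonneg hw _ _)

lemma decomposableFit_comm (w : (∀ δ, I δ) → ℝ) (C₁ C₂ : Finset Δ) :
    decomposableFit w C₁ C₂ = decomposableFit w C₂ C₁ := by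
  funext i
  unfold decomposableFit
  rw [inter_comm C₁ C₂, mul_comm]

/-- If `C₁ ∪ C₂` is everything, two cells glue along their `C₁`- and `C₂`-marginals, in a
unique way, exactly when they agree on `C₁ ∩ C₂`. -/
lemma sum_ite_marg_eq {C₁ C₂ : Finset Δ} (hU : C₁ ∪ C₂ = univ) (k j : ∀ δ, I δ) :
    ∑ i : ∀ δ, I δ, (if marg k C₁ = marg i C₁ ∧ marg j C₂ = marg i C₂ then (1 : ℝ) else 0) =
      if marg j (C₁ ∩ C₂) = marg k (C₁ ∩ C₂) then 1 else 0 := by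
  have hcover : ∀ δ, δ ∈ C₁ ∨ δ ∈ C₂ := fun δ => by
    rw [← mem_union, hU]; exact mem_univ δ
  simp only [marg_eq_iff, mem_inter]
  split_ifs with h
  · rw [sum_eq_single (fun δ => if δ ∈ C₁ then k δ else j δ)]
    · refine if_pos ⟨fun δ hδ => by simp [hδ], fun δ hδ => ?_⟩
      by_cases h1 : δ ∈ C₁
      · simpa [h1] using h δ ⟨h1, hδ⟩
      · simp [h1]
    · rintro b - hb
      refine if_neg fun ⟨hk, hj⟩ => hb (funext fun δ => ?_)
      by_cases h1 : δ ∈ C₁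
      · simp [h1, hk δ h1]
      · simp [h1, hj δ ((hcover δ).resolve_left h1)]
    · simp
  · exact sum_eq_zero fun i _ => if_neg fun ⟨hk, hj⟩ =>
      h fun δ hδ => (hj δ hδ.2).trans (hk δ hδ.1).symm

/-- The fit has the same `C₁`-marginal as `w`. -/
lemma sum_decomposableFit_mul {w : (∀ δ, I δ) → ℝ} (hw : ∀ i, 0 ≤ w i)
    {C₁ C₂ : Finset Δ} (hU : C₁ ∪ C₂ = univ) {φ : (∀ δ, I δ) → ℝ}
    (hφ : ∀ i j, marg i C₁ = marg j C₁ → φ i = φ j) :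
    ∑ i, decomposableFit w C₁ C₂ i * φ i = ∑ i, w i * φ i := by
  have hexpand : ∀ i, decomposableFit w C₁ C₂ i * φ i = ∑ k, ∑ j,
      w k * φ k / margSum w (C₁ ∩ C₂) (marg k (C₁ ∩ C₂)) * (w j *
        if marg k C₁ = marg i C₁ ∧ marg j C₂ = marg i C₂ then (1 : ℝ) else 0) := by
    intro i
    rw [decomposableFit, margSum, margSum, sum_filter, sum_filter, sum_mul_sum, sum_div,
      sum_mul]
    refine sum_congr rfl fun k _ => ?_
    rw [sum_div, sum_mul]
    refine sum_congr rfl fun j _ => ?_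
    by_cases hk : marg k C₁ = marg i C₁
    · have hS : marg k (C₁ ∩ C₂) = marg i (C₁ ∩ C₂) :=
        marg_eq_iff.2 fun δ hδ => marg_eq_iff.1 hk δ (mem_inter.1 hδ).1
      by_cases hj : marg j C₂ = marg i C₂
      · simp only [hk, hj, hS, hφ k i hk, if_true, and_self]
        ring
      · simp [hj]
    · simp [hk]
  simp_rw [hexpand]
  rw [sum_comm]
  refine sum_congr rfl fun k _ => ?_
  rw [sum_comm]
  simp_rw [← mul_sum, sum_ite_marg_eq hU, mul_ite, mul_one, mul_zero]
  rw [← sum_filter, ← margSum]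
  rcases (hw k).eq_or_lt with h0 | hpos
  · simp [← h0]
  · exact div_mul_cancel₀ _ (hpos.trans_le (le_margSum hw _ k)).ne'

/-- Gibbs' inequality, termwise. -/
lemma mul_log_sub_log_le {x y : ℝ} (hx : 0 < x) (hy : 0 < y) :
    y * (Real.log x - Real.log y) ≤ x - y := by
  rw [← Real.log_div hx.ne' hy.ne']
  calc y * Real.log (x / y) ≤ y * (x / y - 1) :=
        mul_le_mul_of_nonneg_left (Real.log_le_sub_one_of_pos (div_pos hx hy)) hy.le
    _ = x - y := by field_simp

/-- Among distributions factorizing over `C₁, C₂`, the fit maximizes the expected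
log-likelihood under `w`. -/
lemma sum_mul_log_le_sum_mul_log_decomposableFit {w : (∀ δ, I δ) → ℝ} (hw : ∀ i, 0 ≤ w i)
    (hw1 : ∑ i, w i = 1) {C₁ C₂ : Finset Δ} (hU : C₁ ∪ C₂ = univ)
    {p : (∀ δ, I δ) → ℝ} (hp0 : ∀ i, 0 ≤ p i) (hp1 : ∑ i, p i = 1)
    (hpw : ∀ i, 0 < w i → 0 < p i)
    {f : (∀ δ : C₁, I δ.1) → ℝ} {g : (∀ δ : C₂, I δ.1) → ℝ}
    (hfact : ∀ i, p i = f (marg i C₁) * g (marg i C₂)) :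
    ∑ i, w i * Real.log (p i) ≤ ∑ i, w i * Real.log (decomposableFit w C₁ C₂ i) := by
  set q := decomposableFit w C₁ C₂ with hq
  set α : (∀ δ, I δ) → ℝ := fun i => Real.log (f (marg i C₁)) -
    Real.log (margSum w C₁ (marg i C₁)) +
    Real.log (margSum w (C₁ ∩ C₂) (marg i (C₁ ∩ C₂))) with hα
  set β : (∀ δ, I δ) → ℝ := fun i => Real.log (g (marg i C₂)) -
    Real.log (margSum w C₂ (marg i C₂)) with hβ
  have hq0 : ∀ i, 0 ≤ q i := decomposableFit_nonneg hw C₁ C₂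
  have hpos : ∀ i, 0 < q i → 0 < p i ∧ α i + β i = Real.log (p i) - Real.log (q i) := by
    intro i hi
    have hne : margSum w C₁ (marg i C₁) ≠ 0 ∧ margSum w C₂ (marg i C₂) ≠ 0 ∧
        margSum w (C₁ ∩ C₂) (marg i (C₁ ∩ C₂)) ≠ 0 := by
      refine ⟨?_, ?_, ?_⟩ <;> intro h <;> simp [hq, decomposableFit, h] at hi
    obtain ⟨h1, h2, hS⟩ := hne
    have hfi : f (marg i C₁) ≠ 0 := by
      obtain ⟨j, hj, hwj⟩ := exists_pos_of_margSum_pos ((margSum_nonneg hw _ _).lt_of_ne' h1)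
      have := (hpw j hwj).ne'
      rw [hfact, hj] at this
      exact left_ne_zero_of_mul this
    have hgi : g (marg i C₂) ≠ 0 := by
      obtain ⟨j, hj, hwj⟩ := exists_pos_of_margSum_pos ((margSum_nonneg hw _ _).lt_of_ne' h2)
      have := (hpw j hwj).ne'
      rw [hfact, hj] at this
      exact right_ne_zero_of_mul this
    refine ⟨(hp0 i).lt_of_ne' (hfact i ▸ mul_ne_zero hfi hgi), ?_⟩
    rw [hfact, Real.log_mul hfi hgi, hq, decomposableFit,
      Real.log_div (mul_ne_zero h1 h2) hS, Real.log_mul h1 h2, hα, hβ]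
    ring
  have hwq : ∀ i, 0 < w i → 0 < q i := fun i hi =>
    div_pos (mul_pos (hi.trans_le (le_margSum hw _ i)) (hi.trans_le (le_margSum hw _ i)))
      (hi.trans_le (le_margSum hw _ i))
  have hwα : ∑ i, q i * α i = ∑ i, w i * α i := by
    refine sum_decomposableFit_mul hw hU fun i j hij => ?_
    have hS : marg i (C₁ ∩ C₂) = marg j (C₁ ∩ C₂) :=
      marg_eq_iff.2 fun δ hδ => marg_eq_iff.1 hij δ (mem_inter.1 hδ).1
    simp only [hα, hij, hS]
  have hwβ : ∑ i, q i * β i = ∑ i, w i * β i := by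
    rw [hq, decomposableFit_comm]
    exact sum_decomposableFit_mul hw (by rwa [union_comm]) fun i j hij => by
      simp only [hβ, hij]
  have hq1 : ∑ i, q i = 1 := by
    have := sum_decomposableFit_mul hw hU (φ := fun _ => 1) fun _ _ _ => rfl
    simpa [hw1] using this
  rw [← sub_nonpos, ← sum_sub_distrib]
  calc ∑ i, (w i * Real.log (p i) - w i * Real.log (q i))
      = ∑ i, w i * (α i + β i) := sum_congr rfl fun i _ => by
        rcases (hw i).eq_or_lt with h0 | h
        · simp [← h0]
        · rw [(hpos i (hwq i h)).2, mul_sub]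
    _ = ∑ i, q i * (α i + β i) := by
        simp only [mul_add, sum_add_distrib, hwα, hwβ]
    _ ≤ ∑ i, (p i - q i) := sum_le_sum fun i _ => by
        rcases (hq0 i).eq_or_lt with h0 | h
        · simpa [← h0] using hp0 i
        · rw [(hpos i h).2]
          exact mul_log_sub_log_le (hpos i h).1 h
    _ = 0 := by rw [sum_sub_distrib, hp1, hq1, sub_self]

end DecomposableModel

/-- Let `Δ = C₁ ∪ C₂`, `S = C₁ ∩ C₂`, let `n` be a cell frequency function with positive
total count `N`, let `r a t` be the relative frequency of the `a`-marginal cell `t`, and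
let `q i = r C₁ (i_{C₁}) * r C₂ (i_{C₂}) / r S (i_S)` when `r S (i_S) > 0`, `q i = 0`
otherwise.  Then `q` maximizes the log-likelihood over the decomposable model with
cliques `C₁, C₂`: for every probability distribution `p` on the cells that is positive
on observed cells and factorizes as `p i = f (i_{C₁}) * g (i_{C₂})` with `f, g`
nonnegative, `∑_{i : n i > 0} n i * log (p i) ≤ ∑_{i : n i > 0} n i * log (q i)`. -/
theorem stmt11 {Δ : Type*} [Fintype Δ] [DecidableEq Δ] {I : Δ → Type*}
    [∀ δ, Fintype (I δ)] [∀ δ, DecidableEq (I δ)]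
    (C₁ C₂ : Finset Δ) (hU : C₁ ∪ C₂ = Finset.univ)
    (n : (∀ δ, I δ) → ℕ) (hN : 0 < ∑ i, n i)
    (p : (∀ δ, I δ) → ℝ) (hp0 : ∀ i, 0 ≤ p i) (hp1 : ∑ i, p i = 1)
    (hpn : ∀ i, 0 < n i → 0 < p i)
    (f : (∀ δ : C₁, I δ.1) → ℝ) (g : (∀ δ : C₂, I δ.1) → ℝ)
    (hf : ∀ t, 0 ≤ f t) (hg : ∀ u, 0 ≤ g u)
    (hfact : ∀ i, p i = f (marg i C₁) * g (marg i C₂)) :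
    let S : Finset Δ := C₁ ∩ C₂
    let N : ℝ := ∑ i, (n i : ℝ)
    let r : (a : Finset Δ) → (∀ δ : a, I δ.1) → ℝ := fun a t =>
      (∑ j ∈ univ.filter (fun j => marg j a = t), (n j : ℝ)) / N
    let q : (∀ δ, I δ) → ℝ := fun i =>
      if 0 < r S (marg i S) then r C₁ (marg i C₁) * r C₂ (marg i C₂) / r S (marg i S)
      else 0
    ∑ i ∈ univ.filter (fun i => 0 < n i), (n i : ℝ) * Real.log (p i) ≤
      ∑ i ∈ univ.filter (fun i => 0 < n i), (n i : ℝ) * Real.log (q i) := by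
  intro S N r q
  have hNpos : 0 < N := by
    simpa only [N, Nat.cast_sum] using (Nat.cast_pos (α := ℝ)).2 hN
  set w : (∀ δ, I δ) → ℝ := fun i => n i / N with hwdef
  have hw : ∀ i, 0 ≤ w i := fun i => div_nonneg (Nat.cast_nonneg _) hNpos.le
  have hr : ∀ a t, r a t = margSum w a t := fun a t => sum_div _ _ _
  have hqw : ∀ i, q i = decomposableFit w C₁ C₂ i := by
    intro i
    simp only [q, hr, decomposableFit]
    split_ifs with h
    · rfl
    · rw [le_antisymm (not_lt.1 h) (margSum_nonneg hw _ _), div_zero]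
  have hsum : ∀ h : (∀ δ, I δ) → ℝ,
      ∑ i ∈ univ.filter (fun i => 0 < n i), (n i : ℝ) * h i = N * ∑ i, w i * h i := by
    intro h
    rw [mul_sum, sum_filter]
    refine sum_congr rfl fun i _ => ?_
    rw [← mul_assoc, hwdef, mul_div_cancel₀ _ hNpos.ne']
    split_ifs with hi
    · rfl
    · simp [Nat.eq_zero_of_not_pos hi]
  simp_rw [hsum, hqw]
  refine mul_le_mul_of_nonneg_left ?_ hNpos.le
  refine sum_mul_log_le_sum_mul_log_decomposableFit hw ?_ hU hp0 hp1 (fun i hi => hpn i ?_)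
    hfact
  · rw [hwdef, ← sum_div]
    exact div_self hNpos.ne'
  · refine Nat.pos_of_ne_zero fun h0 => ?_
    simp [hwdef, h0] at hi
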